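/- arXiv:1804.00178 — 2 statements merged into one kernel-verified Lean document; each statement's English description precedes it below -/
import Mathlib

section
/- Let P^• be a complete flag in H, let a_• be a strictly increasing sequence as in the context, and let Λ ∈ Σ_{P^•,a_•}. Let S be the set of indices i active in a_• with dim_k(Λ ∩ P^{a_i}) = r + 1 − i, and let T_1 := {φ ∈ Hom_k(Λ, H/Λ) : φ(Λ ∩ P^{a_i}) ⊆ (P^{a_i} + Λ)/Λ for all i ∈ S}. Then dim_k T_1 ≥ (r+1)(d−r−1) − Σ_{i=0}^r (a_i − i), with equality if and only if every index active in a_• belongs to S, i.e., if and only if Λ ∈ Σ°_{P^•,a_•}. -/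
open Module Submodule

section Defs

variable (k : Type*) [Field k] {H : Type*} [AddCommGroup H] [Module k H]

/-- A complete flag in `H`, indexed by codimension: `P 0 = H ⊇ P 1 ⊇ ⋯ ⊇ P d = 0`
with `dim (P i) = d - i`. -/
def IsCompleteFlag (d : ℕ) (P : ℕ → Submodule k H) : Prop :=
  (∀ i ≤ d, Module.finrank k ↥(P i) = d - i) ∧ ∀ i < d, P (i + 1) ≤ P i

/-- `e` is a `(P,Q)`-basis with associated permutation `τ` (0-indexed: the basis vector
`e ℓ` corresponds to `e_{ℓ+1}` of the paper, and `(τ ℓ).val + 1` to `τ(ℓ+1)`):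
`e ℓ ∈ P^ℓ ∖ P^{ℓ+1}` and `e ℓ ∈ Q^{τ ℓ} ∖ Q^{τ ℓ + 1}`. -/
def IsFlagPermBasis (d : ℕ) (P Q : ℕ → Submodule k H)
    (τ : Equiv.Perm (Fin d)) (e : Fin d → H) : Prop :=
  LinearIndependent k e ∧ Submodule.span k (Set.range e) = ⊤ ∧
  (∀ ℓ : Fin d, e ℓ ∈ P ℓ.val ∧ e ℓ ∉ P (ℓ.val + 1)) ∧
  (∀ ℓ : Fin d, e ℓ ∈ Q (τ ℓ).val ∧ e ℓ ∉ Q ((τ ℓ).val + 1))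

/-- Complete flags `P`, `Q` are transverse: `P^i ∩ Q^{d-i} = 0` for `0 < i < d`. -/
def FlagsTransverse (d : ℕ) (P Q : ℕ → Submodule k H) : Prop :=
  ∀ i, 0 < i → i < d → P i ⊓ Q (d - i) = ⊥

/-- Complete flags `P`, `Q` are almost-transverse. -/
def FlagsAlmostTransverse (d : ℕ) (P Q : ℕ → Submodule k H) : Prop :=
  ∃ t, 1 ≤ t ∧ t < d ∧ Module.finrank k ↥(P t ⊓ Q (d - t)) = 1 ∧
    ∀ i, 1 ≤ i → i < d → i ≠ t → Module.finrank k ↥(P i ⊓ Q (d - i)) = 0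

/-- The index `i` is active in the sequence `a`. -/
def ActiveIdx (a : ℕ → ℕ) (i : ℕ) : Prop :=
  (i = 0 ∧ 0 < a 0) ∨ (0 < i ∧ a (i - 1) + 1 < a i)

/-- `Λ` lies in the Schubert variety `Σ_{P,a}` (for `Λ` of dimension `r+1`). -/
def MemSchubert (r : ℕ) (P : ℕ → Submodule k H) (a : ℕ → ℕ) (Λ : Submodule k H) : Prop :=
  ∀ i ≤ r, r + 1 - i ≤ Module.finrank k ↥(Λ ⊓ P (a i))

/-- `Λ` lies in the open subset `Σ°_{P,a}` of the Schubert variety. -/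
def MemSchubertOpen (r : ℕ) (P : ℕ → Submodule k H) (a : ℕ → ℕ) (Λ : Submodule k H) : Prop :=
  MemSchubert k r P a Λ ∧
    ∀ i ≤ r, ActiveIdx a i → Module.finrank k ↥(Λ ⊓ P (a i)) = r + 1 - i

/-- `lam` is an adapted basis of `Λ` for the flags `Λ ∩ P^•` and `Λ ∩ Q^•`, with associated
permutation `σ`: `lam j` lies in the codimension-`j` member of the flag `Λ ∩ P^•` but not in
the codimension-`(j+1)` member (membership in a member of the flag `Λ ∩ P^•` being equivalent
to that member having dimension at least `r + 1 - j`), and likewise for `Λ ∩ Q^•` with `σ j`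
in place of `j`. -/
def IsAdaptedBasis (d r : ℕ) (P Q : ℕ → Submodule k H) (Λ : Submodule k H)
    (σ : Equiv.Perm (Fin (r + 1))) (lam : Fin (r + 1) → H) : Prop :=
  LinearIndependent k lam ∧ Submodule.span k (Set.range lam) = Λ ∧
  (∀ j : Fin (r + 1), ∀ i ≤ d,
    (lam j ∈ Λ ⊓ P i ↔ r + 1 - j.val ≤ Module.finrank k ↥(Λ ⊓ P i))) ∧
  (∀ j : Fin (r + 1), ∀ i ≤ d,
    (lam j ∈ Λ ⊓ Q i ↔ r + 1 - (σ j).val ≤ Module.finrank k ↥(Λ ⊓ Q i)))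

/-- The subspace of `Hom(Λ, H/Λ)` of maps `φ` with `φ(Λ ∩ P^{a i}) ⊆ (P^{a i} + Λ)/Λ`
for all `i ∈ S`. -/
def schubertTangent (P : ℕ → Submodule k H) (a : ℕ → ℕ) (Λ : Submodule k H) (S : Set ℕ) :
    Submodule k (↥Λ →ₗ[k] H ⧸ Λ) :=
  ⨅ i ∈ S, Submodule.compatibleMaps
    (Submodule.comap Λ.subtype (P (a i))) (Submodule.map Λ.mkQ (P (a i)))

/-- The tangent-space model `T(Λ)` at `Λ ∈ Σ°_{P,a} ∩ Σ°_{Q,b}`: all `φ : Λ → H/Λ` with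
`φ(Λ ∩ P^{a i}) ⊆ (P^{a i} + Λ)/Λ` for every `i` active in `a` and
`φ(Λ ∩ Q^{b i}) ⊆ (Q^{b i} + Λ)/Λ` for every `i` active in `b`. -/
def pairTangent (r : ℕ) (P Q : ℕ → Submodule k H) (a b : ℕ → ℕ) (Λ : Submodule k H) :
    Submodule k (↥Λ →ₗ[k] H ⧸ Λ) :=
  schubertTangent k P a Λ {i | i ≤ r ∧ ActiveIdx a i} ⊓
    schubertTangent k Q b Λ {i | i ≤ r ∧ ActiveIdx b i}

/-- The number of inversions of a permutation of `Fin d`. -/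
def invCount {d : ℕ} (τ : Equiv.Perm (Fin d)) : ℕ :=
  ((Finset.univ : Finset (Fin d × Fin d)).filter fun p => p.1 < p.2 ∧ τ p.2 < τ p.1).card

end Defs

/-- Rank-nullity for the restriction of a linear map to a submodule. -/
lemma Submodule.finrank_map_add_finrank_inf_ker {k A B : Type*} [Field k] [AddCommGroup A]
    [Module k A] [FiniteDimensional k A] [AddCommGroup B] [Module k B]
    (f : A →ₗ[k] B) (T : Submodule k A) :
    finrank k ↥(T.map f) + finrank k ↥(T ⊓ LinearMap.ker f) = finrank k ↥T := by
  rw [← LinearMap.finrank_range_add_finrank_ker (f.domRestrict T), LinearMap.range_domRestrict]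
  congr 1
  have h : (LinearMap.ker (f.domRestrict T)).map T.subtype = T ⊓ LinearMap.ker f := by
    rw [LinearMap.ker_domRestrict, Submodule.map_comap_subtype]
  rw [← h]
  exact Submodule.finrank_map_subtype_eq T _

/-- If `T` is a space of maps sending `V` into `W'` which contains all maps with image in `W'`,
then imposing `φ V ⊆ W` for some `W ≤ W'` cuts its dimension by `dim V * (dim W' - dim W)`. -/
lemma Submodule.finrank_inf_compatibleMaps {k A B : Type*} [Field k] [AddCommGroup A]
    [Module k A] [FiniteDimensional k A] [AddCommGroup B] [Module k B] [FiniteDimensional k B]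
    (T : Submodule k (A →ₗ[k] B)) (V : Submodule k A) (W W' : Submodule k B) (hW : W ≤ W')
    (hTV : ∀ φ ∈ T, ∀ v ∈ V, φ v ∈ W') (hT : ∀ φ : A →ₗ[k] B, (∀ x, φ x ∈ W') → φ ∈ T) :
    finrank k ↥(T ⊓ compatibleMaps V W) + finrank k ↥V * finrank k ↥W' =
      finrank k ↥T + finrank k ↥V * finrank k ↥W := by
  let f : (A →ₗ[k] B) →ₗ[k] (V →ₗ[k] B ⧸ W) :=
    (LinearMap.lcomp k (B ⧸ W) V.subtype) ∘ₗ (LinearMap.compRight k W.mkQ)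
  have hf (φ : A →ₗ[k] B) (v : V) : f φ v = W.mkQ (φ v) := rfl
  have hker : LinearMap.ker f = compatibleMaps V W := by
    ext φ
    simp only [LinearMap.mem_ker, LinearMap.ext_iff, hf, LinearMap.zero_apply, mkQ_apply,
      Quotient.mk_eq_zero]
    exact ⟨fun h x hx => h ⟨x, hx⟩, fun h v => h v.2⟩
  let g : (V →ₗ[k] W'.map W.mkQ) →ₗ[k] (V →ₗ[k] B ⧸ W) :=
    LinearMap.compRight k (W'.map W.mkQ).subtype
  have hg (ψ : V →ₗ[k] W'.map W.mkQ) (v : V) : g ψ v = (ψ v : B ⧸ W) := rfl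
  have hginj : Function.Injective g := by
    intro ψ₁ ψ₂ h
    ext v
    rw [← hg, ← hg, h]
  have hmap : T.map f = LinearMap.range g := by
    apply le_antisymm
    · rintro _ ⟨φ, hφ, rfl⟩
      refine ⟨(f φ).codRestrict _ fun v => ⟨φ v, hTV φ hφ v v.2, rfl⟩, ?_⟩
      ext v
      rfl
    · rintro _ ⟨ψ, rfl⟩
      obtain ⟨s, hs⟩ := (W.mkQ.submoduleMap W').exists_rightInverse_of_surjective
        (LinearMap.range_eq_top.2 (W.mkQ.submoduleMap_surjective W'))
      obtain ⟨φ, hφ⟩ := LinearMap.exists_extend (s ∘ₗ ψ)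
      refine ⟨W'.subtype ∘ₗ φ, hT _ fun x => (φ x).2, ?_⟩
      ext v
      have h₁ : φ v = s (ψ v) := LinearMap.congr_fun hφ v
      have h₂ := congrArg Subtype.val (LinearMap.congr_fun hs (ψ v))
      rw [hf, hg]
      simpa [h₁] using h₂
  have h₁ := finrank_map_add_finrank_inf_ker f T
  have h₂ := finrank_map_add_finrank_inf_ker W.mkQ W'
  rw [hker, hmap, LinearMap.finrank_range_of_inj hginj, Module.finrank_linearMap] at h₁
  rw [ker_mkQ, inf_eq_right.2 hW] at h₂
  rw [← h₁, ← h₂]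
  ring

lemma mem_schubertTangent {k H : Type*} [Field k] [AddCommGroup H] [Module k H]
    {P : ℕ → Submodule k H} {a : ℕ → ℕ} {Λ : Submodule k H} {S : Set ℕ}
    {φ : ↥Λ →ₗ[k] H ⧸ Λ} :
    φ ∈ schubertTangent k P a Λ S ↔
      ∀ i ∈ S, ∀ x : Λ, (x : H) ∈ P (a i) → φ x ∈ (P (a i)).map Λ.mkQ := by
  simp only [schubertTangent, mem_iInf]
  rfl

open Classical in
/-- The value `a i - i` at the largest `i < n` lying in `S`, or `0` if there is none. -/
noncomputable def lastExcess (a : ℕ → ℕ) (S : Set ℕ) : ℕ → ℤ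
  | 0 => 0
  | n + 1 => if n ∈ S then (a n : ℤ) - n else lastExcess a S n

/-- The dimension of the space cut out by the conditions with index `i ∈ S`, `i < n`. The
subspace `W` is the image of the last `P (a i)` imposed. -/
lemma finrank_schubertTangent_lt {k H : Type*} [Field k] [AddCommGroup H] [Module k H]
    [FiniteDimensional k H] {P : ℕ → Submodule k H} {a : ℕ → ℕ} {r : ℕ} {Λ : Submodule k H}
    (hΛ : finrank k Λ = r + 1) (hPa : ∀ i j, i ≤ j → j ≤ r → P (a j) ≤ P (a i)) {S : Set ℕ}
    (hPS : ∀ i ∈ S, finrank k ↥(P (a i)) + a i = finrank k H)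
    (hS : ∀ i ∈ S, i ≤ r ∧ finrank k ↥(Λ ⊓ P (a i)) = r + 1 - i) (n : ℕ) (hn : n ≤ r + 1) :
    (finrank k ↥(schubertTangent k P a Λ {i | i < n ∧ i ∈ S}) : ℤ) =
        ((r : ℤ) + 1) * ((finrank k H : ℤ) - r - 1) -
          ∑ j ∈ Finset.range n, lastExcess a S (j + 1) - ((r : ℤ) + 1 - n) * lastExcess a S n ∧
      ∃ W : Submodule k (H ⧸ Λ),
        (finrank k W : ℤ) = (finrank k H : ℤ) - r - 1 - lastExcess a S n ∧
        (∀ i < n, i ∈ S → W ≤ (P (a i)).map Λ.mkQ) ∧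
        ∀ m, n ≤ m → m ≤ r → (P (a m)).map Λ.mkQ ≤ W ∧
          ∀ φ ∈ schubertTangent k P a Λ {i | i < n ∧ i ∈ S},
            ∀ x : Λ, (x : H) ∈ P (a m) → φ x ∈ W := by
  have hQ : (finrank k (H ⧸ Λ) : ℤ) = (finrank k H : ℤ) - r - 1 := by
    have := Λ.finrank_quotient_add_finrank
    omega
  induction n with
  | zero =>
    refine ⟨?_, ⊤, ?_, by simp, fun m _ _ => ⟨le_top, fun _ _ _ _ => mem_top⟩⟩
    · have h : schubertTangent k P a Λ {i | i < 0 ∧ i ∈ S} = ⊤ := by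
        ext φ
        simp [mem_schubertTangent]
      rw [h, finrank_top, Module.finrank_linearMap, hΛ]
      push_cast
      rw [hQ]
      simp [lastExcess]
    · rw [finrank_top, hQ]
      simp [lastExcess]
  | succ n ih =>
    obtain ⟨hT, W, hW, hWle, hleW⟩ := ih (by omega)
    by_cases hnS : n ∈ S
    · have hlast : lastExcess a S (n + 1) = (a n : ℤ) - n := by simp [lastExcess, hnS]
      have hV : finrank k ↥((P (a n)).comap Λ.subtype) = r + 1 - n := by
        rw [← (hS n hnS).2, ← Submodule.finrank_map_subtype_eq, Submodule.map_comap_subtype]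
      have hWn : (finrank k ↥((P (a n)).map Λ.mkQ) : ℤ) =
          (finrank k H : ℤ) - r - 1 - lastExcess a S (n + 1) := by
        have h₁ := finrank_map_add_finrank_inf_ker Λ.mkQ (P (a n))
        rw [ker_mkQ, inf_comm, (hS n hnS).2] at h₁
        have := hPS n hnS
        omega
      have hTn : schubertTangent k P a Λ {i | i < n + 1 ∧ i ∈ S} =
          schubertTangent k P a Λ {i | i < n ∧ i ∈ S} ⊓
            compatibleMaps ((P (a n)).comap Λ.subtype) ((P (a n)).map Λ.mkQ) := by
        ext φ
        rw [mem_inf, mem_schubertTangent, mem_schubertTangent]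
        constructor
        · exact fun h => ⟨fun i hi => h i ⟨hi.1.trans n.lt_succ_self, hi.2⟩,
            fun x hx => h n ⟨n.lt_succ_self, hnS⟩ x hx⟩
        · rintro ⟨h₁, h₂⟩ i ⟨hi, hiS⟩ x hx
          rcases Nat.lt_succ_iff_lt_or_eq.1 hi with hi | rfl
          · exact h₁ i ⟨hi, hiS⟩ x hx
          · exact h₂ hx
      refine ⟨?_, (P (a n)).map Λ.mkQ, hWn, fun i hi _ => map_mono (hPa i n (by omega) (by omega)),
        fun m hnm hmr => ⟨map_mono (hPa n m (by omega) hmr), fun φ hφ x hx =>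
          mem_schubertTangent.1 hφ n ⟨n.lt_succ_self, hnS⟩ x (hPa n m (by omega) hmr hx)⟩⟩
      have key := finrank_inf_compatibleMaps (schubertTangent k P a Λ {i | i < n ∧ i ∈ S})
        ((P (a n)).comap Λ.subtype) ((P (a n)).map Λ.mkQ) W (hleW n le_rfl (by omega)).1
        (fun φ hφ v hv => (hleW n le_rfl (by omega)).2 φ hφ v hv)
        (fun φ hφ => mem_schubertTangent.2 fun i hi x _ => hWle i hi.1 hi.2 (hφ x))
      rw [← hTn, hV] at key
      zify at key
      rw [Nat.cast_sub (by omega : n ≤ r + 1)] at key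
      push_cast at key
      rw [hT, hW, hWn] at key
      rw [Finset.sum_range_succ]
      push_cast
      linear_combination key
    · have hlast : lastExcess a S (n + 1) = lastExcess a S n := by simp [lastExcess, hnS]
      have hSn : {i | i < n + 1 ∧ i ∈ S} = {i | i < n ∧ i ∈ S} := by
        ext i
        simp only [Set.mem_ofPred_eq, and_congr_left_iff]
        intro hi
        have : i ≠ n := fun h => hnS (h ▸ hi)
        omega
      rw [hSn, hlast, Finset.sum_range_succ, hlast]
      refine ⟨?_, W, hW, fun i hi hiS => hWle i ?_ hiS, fun m hnm hmr => hleW m (by omega) hmr⟩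
      · rw [hT]
        push_cast
        ring
      · have : i ≠ n := fun h => hnS (h ▸ hiS)
        omega

lemma lastExcess_succ_le {a : ℕ → ℕ} {r : ℕ} (ha : ∀ i < r, a i < a (i + 1)) (S : Set ℕ)
    {j : ℕ} (hj : j ≤ r) : lastExcess a S (j + 1) ≤ (a j : ℤ) - j := by
  induction j with
  | zero =>
    rw [lastExcess]
    split_ifs <;> simp [lastExcess]
  | succ j ih =>
    have h₁ := ih (by omega)
    have h₂ := ha j (by omega)
    rw [lastExcess]
    split_ifs
    · exact le_rfl
    · push_cast
      omega

lemma lastExcess_succ_eq_iff {a : ℕ → ℕ} {r : ℕ} (ha : ∀ i < r, a i < a (i + 1)) (S : Set ℕ) :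
    (∀ j ≤ r, lastExcess a S (j + 1) = (a j : ℤ) - j) ↔ ∀ j ≤ r, ActiveIdx a j → j ∈ S := by
  constructor
  · intro h j hj hact
    by_contra hjS
    have h₁ := h j hj
    rw [lastExcess, if_neg hjS] at h₁
    cases j with
    | zero =>
      simp only [lastExcess] at h₁
      rcases hact with hact | hact <;> omega
    | succ j =>
      have h₂ := h j (by omega)
      rcases hact with hact | ⟨-, hact⟩
      · omega
      · rw [Nat.add_sub_cancel] at hact
        push_cast at h₁
        omega
  · intro h j hj
    induction j with
    | zero =>
      rw [lastExcess]
      split_ifs with hS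
      · rfl
      · have : ¬ 0 < a 0 := fun h₀ => hS (h 0 hj (Or.inl ⟨rfl, h₀⟩))
        simp only [lastExcess]
        omega
    | succ j ih =>
      have h₁ := ih (by omega)
      have h₂ := ha j (by omega)
      rw [lastExcess]
      split_ifs with hS
      · rfl
      · have : ¬ a j + 1 < a (j + 1) := fun h₀ =>
          hS (h (j + 1) hj (Or.inr ⟨j.succ_pos, h₀⟩))
        push_cast
        omega

/-- for `Λ ∈ Σ_{P,a}`, with `S` the set of active indices `i` at which
`dim (Λ ∩ P^{a i}) = r + 1 - i` and `T₁` the corresponding space of maps `φ : Λ → H/Λ`,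
one has `dim T₁ ≥ (r+1)(d-r-1) - Σ_i (a_i - i)`, with equality iff every active index
lies in `S`, i.e. iff `Λ ∈ Σ°_{P,a}`. -/
theorem schubertTangent_dim_lower_bound (k H : Type*) [Field k] [IsAlgClosed k]
    [AddCommGroup H] [Module k H] (d : ℕ) (hd : 1 ≤ d)
    (hH : Module.finrank k H = d) (P : ℕ → Submodule k H)
    (hP : IsCompleteFlag k d P)
    (r : ℕ) (a : ℕ → ℕ) (ha : ∀ i < r, a i < a (i + 1)) (had : a r < d)
    (Λ : Submodule k H) (hΛ : Module.finrank k ↥Λ = r + 1)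
    (hΛS : MemSchubert k r P a Λ) :
    ((r : ℤ) + 1) * ((d : ℤ) - (r : ℤ) - 1) -
        (∑ i ∈ Finset.range (r + 1), ((a i : ℤ) - (i : ℤ))) ≤
      (Module.finrank k ↥(schubertTangent k P a Λ
        {i | i ≤ r ∧ ActiveIdx a i ∧
          Module.finrank k ↥(Λ ⊓ P (a i)) = r + 1 - i}) : ℤ) ∧
    ((Module.finrank k ↥(schubertTangent k P a Λ
        {i | i ≤ r ∧ ActiveIdx a i ∧
          Module.finrank k ↥(Λ ⊓ P (a i)) = r + 1 - i}) : ℤ) =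
      ((r : ℤ) + 1) * ((d : ℤ) - (r : ℤ) - 1) -
        (∑ i ∈ Finset.range (r + 1), ((a i : ℤ) - (i : ℤ))) ↔
      ∀ i ≤ r, ActiveIdx a i →
        Module.finrank k ↥(Λ ⊓ P (a i)) = r + 1 - i) := by
  have : FiniteDimensional k H := FiniteDimensional.of_finrank_pos (by omega)
  have hanti : ∀ i j, i ≤ j → j ≤ d → P j ≤ P i := by
    intro i j hij
    induction j, hij using Nat.le_induction with
    | base => exact fun _ => le_rfl
    | succ j _ ih => exact fun hj => (hP.2 j hj).trans (ih (by omega))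
  have hmono : ∀ i j, i ≤ j → j ≤ r → a i ≤ a j := by
    intro i j hij
    induction j, hij using Nat.le_induction with
    | base => exact fun _ => le_rfl
    | succ j _ ih => exact fun hj => (ih (by omega)).trans (ha j hj).le
  have had' : ∀ i ≤ r, a i ≤ d := fun i hi => (hmono i r hi le_rfl).trans had.le
  set S : Set ℕ := {i | i ≤ r ∧ ActiveIdx a i ∧ finrank k ↥(Λ ⊓ P (a i)) = r + 1 - i}
  have hdim := (finrank_schubertTangent_lt (S := S) hΛ
    (fun i j hij hj => hanti _ _ (hmono i j hij hj) (had' j hj))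
    (fun i hi => by rw [hP.1 _ (had' i hi.1), hH]; have := had' i hi.1; omega)
    (fun i hi => ⟨hi.1, hi.2.2⟩) (r + 1) le_rfl).1
  have hSlt : {i | i < r + 1 ∧ i ∈ S} = S := by
    ext i
    exact ⟨fun h => h.2, fun h => ⟨Nat.lt_succ_of_le h.1, h⟩⟩
  rw [hSlt, hH] at hdim
  push_cast at hdim
  rw [sub_self, zero_mul, sub_zero] at hdim
  have hle : ∀ j ∈ Finset.range (r + 1), lastExcess a S (j + 1) ≤ (a j : ℤ) - j :=
    fun j hj => lastExcess_succ_le ha S (Nat.lt_succ_iff.1 (Finset.mem_range.1 hj))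
  rw [hdim]
  refine ⟨sub_le_sub_left (Finset.sum_le_sum hle) _, ?_⟩
  rw [sub_right_inj, Finset.sum_eq_sum_iff_of_le hle]
  simp only [Finset.mem_range, Nat.lt_succ_iff]
  rw [lastExcess_succ_eq_iff ha S]
  exact ⟨fun h i hi hact => (h i hi hact).2.2, fun h i hi hact => ⟨hi, hact, h i hi hact⟩⟩
end

section
/- Let P^•, Q^• be complete flags in H, let a_•, b_• be strictly increasing sequences as in the context, and let Λ ∈ Σ°_{P^•,a_•} ∩ Σ°_{Q^•,b_•}, with σ, m(j), n(j), T(Λ) and E as defined in the context. Then dim_k T(Λ) = E + Σ_{j=0}^r (d − dim_k(P^{m(j)} + Q^{n(j)} + Λ)). -/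
open Module Submodule

/-- Up to an index `j`, an increasing sequence `a` has a last active index `i` (or `i = 0` with
`a 0 = 0`), after which `a` grows by exactly one at each step; its value is the supremum of the
active values up to `j`. -/
theorem exists_last_activeIdx {r : ℕ} {a : ℕ → ℕ} (ha : ∀ i < r, a i < a (i + 1)) {j : ℕ}
    (hj : j ≤ r) :
    ∃ i ≤ j, sSup {x | ∃ i ≤ j, ActiveIdx a i ∧ x = a i} = a i ∧ a j + i = a i + j ∧
      (ActiveIdx a i ∨ (i = 0 ∧ a 0 = 0)) ∧ ∀ l ≤ j, ActiveIdx a l → a l ≤ a i := by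
  suffices h : ∃ i ≤ j, a j + i = a i + j ∧ (ActiveIdx a i ∨ (i = 0 ∧ a 0 = 0)) ∧
      ∀ l ≤ j, ActiveIdx a l → a l ≤ a i by
    obtain ⟨i, hij, hstep, hact, hmax⟩ := h
    refine ⟨i, hij, ?_, hstep, hact, hmax⟩
    have hub : a i ∈ upperBounds {x | ∃ i ≤ j, ActiveIdx a i ∧ x = a i} := by
      rintro x ⟨l, hl, hla, rfl⟩
      exact hmax l hl hla
    refine le_antisymm (csSup_le' hub) ?_
    rcases hact with hact | ⟨rfl, h0⟩
    · exact le_csSup ⟨_, hub⟩ ⟨i, hij, hact, rfl⟩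
    · simp [h0]
  induction j with
  | zero =>
    refine ⟨0, le_rfl, rfl, ?_, ?_⟩
    · rcases Nat.eq_zero_or_pos (a 0) with h | h
      · exact Or.inr ⟨rfl, h⟩
      · exact Or.inl (Or.inl ⟨rfl, h⟩)
    · intro l hl _
      rw [Nat.le_zero.mp hl]
  | succ j ih =>
    obtain ⟨i, hij, hstep, hact, hmax⟩ := ih (by lia)
    have hlt := ha j (by lia)
    by_cases hj1 : ActiveIdx a (j + 1)
    · refine ⟨j + 1, le_rfl, rfl, Or.inl hj1, fun l hl hla => ?_⟩
      rcases hl.lt_or_eq with hl | rfl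
      · have := hmax l (by lia) hla
        lia
      · exact le_rfl
    · refine ⟨i, by lia, ?_, hact, fun l hl hla => ?_⟩
      · have : ¬ a j + 1 < a (j + 1) := fun h => hj1 (Or.inr ⟨j.succ_pos, h⟩)
        lia
      · rcases hl.lt_or_eq with hl | rfl
        · exact hmax l (by lia) hla
        · exact absurd hla hj1

section LinearAlgebra

variable {k H : Type*} [Field k] [AddCommGroup H] [Module k H]

theorem finrank_map_mkQ_add_finrank_inf [FiniteDimensional k H] (Λ S : Submodule k H) :
    finrank k (S.map Λ.mkQ) + finrank k ↥(Λ ⊓ S) = finrank k S := by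
  have h := LinearMap.finrank_range_add_finrank_ker (Λ.mkQ.domRestrict S)
  rw [LinearMap.range_domRestrict, LinearMap.ker_domRestrict, ker_mkQ] at h
  rw [← h, inf_comm, ← Submodule.map_comap_subtype, finrank_map_subtype_eq]

theorem finrank_map_mkQ_add_finrank [FiniteDimensional k H] (Λ S : Submodule k H) :
    finrank k (S.map Λ.mkQ) + finrank k Λ = finrank k ↥(S ⊔ Λ) := by
  have h₁ := finrank_map_mkQ_add_finrank_inf Λ S
  have h₂ := finrank_sup_add_finrank_inf_eq S Λ
  rw [inf_comm] at h₂
  lia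

/-- The space of linear maps sending each vector `B j` of a basis into a prescribed subspace `p j`
has dimension `∑ j, dim (p j)`. -/
theorem finrank_eq_sum_of_mem_iff_basis {ι V W : Type*} [Fintype ι] [AddCommGroup V] [Module k V]
    [AddCommGroup W] [Module k W] [FiniteDimensional k W] (B : Basis ι k V)
    (p : ι → Submodule k W) (T : Submodule k (V →ₗ[k] W))
    (hT : ∀ φ, φ ∈ T ↔ ∀ j, φ (B j) ∈ p j) : finrank k T = ∑ j, finrank k (p j) := by
  rw [← finrank_pi_fintype]
  refine LinearEquiv.finrank_eq (LinearEquiv.ofBijective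
    (LinearMap.pi fun j => LinearMap.codRestrict (p j)
      ((LinearMap.applyₗ (B j)).domRestrict T) fun φ => (hT φ).1 φ.2 j) ⟨?_, ?_⟩)
  · intro φ ψ h
    refine Subtype.ext (B.ext fun j => ?_)
    exact congrArg Subtype.val (congrFun h j)
  · intro f
    refine ⟨⟨B.constr k fun j => (f j : W), (hT _).2 fun j => ?_⟩, ?_⟩
    · rw [B.constr_basis]
      exact (f j).2
    · ext j
      exact B.constr_basis k _ j

theorem IsCompleteFlag.zero_eq_top [FiniteDimensional k H] {d : ℕ} {P : ℕ → Submodule k H}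
    (hP : IsCompleteFlag k d P) (hH : finrank k H = d) : P 0 = ⊤ :=
  eq_top_of_finrank_eq (by rw [hP.1 0 d.zero_le, hH, Nat.sub_zero])

theorem IsCompleteFlag.le_of_le {d : ℕ} {P : ℕ → Submodule k H} (hP : IsCompleteFlag k d P)
    {i j : ℕ} (hij : i ≤ j) (hj : j ≤ d) : P j ≤ P i := by
  induction j, hij using Nat.le_induction with
  | base => exact le_rfl
  | succ j _ ih => exact (hP.2 j hj).trans (ih (by lia))

theorem MemSchubertOpen.finrank_map_mkQ [FiniteDimensional k H] {d r : ℕ} {P : ℕ → Submodule k H}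
    (hP : IsCompleteFlag k d P) (hH : finrank k H = d) {a : ℕ → ℕ}
    (ha : ∀ i < r, a i < a (i + 1)) (had : ∀ i ≤ r, a i < d) {Λ : Submodule k H}
    (hΛ : finrank k Λ = r + 1) (hΛa : MemSchubertOpen k r P a Λ) {j : ℕ} (hj : j ≤ r) :
    (finrank k ((P (sSup {x | ∃ i ≤ j, ActiveIdx a i ∧ x = a i})).map Λ.mkQ) : ℤ) =
      d - r - 1 - (a j - j) := by
  obtain ⟨i, hij, hsup, hstep, hact, -⟩ := exists_last_activeIdx ha hj
  rw [hsup]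
  have h₁ := finrank_map_mkQ_add_finrank_inf Λ (P (a i))
  have had' := had i (hij.trans hj)
  rw [hP.1 _ had'.le] at h₁
  have h₂ : finrank k ↥(Λ ⊓ P (a i)) = r + 1 - i := by
    rcases hact with hact | ⟨rfl, h0⟩
    · exact hΛa.2 i (hij.trans hj) hact
    · rw [h0, hP.zero_eq_top hH, inf_top_eq, hΛ, Nat.sub_zero]
  lia

theorem mem_schubertTangent_iff_basis [FiniteDimensional k H] {d r : ℕ} {P : ℕ → Submodule k H}
    (hP : IsCompleteFlag k d P) (hH : finrank k H = d) {a : ℕ → ℕ}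
    (ha : ∀ i < r, a i < a (i + 1)) (had : ∀ i ≤ r, a i < d) {Λ : Submodule k H}
    (hΛa : MemSchubertOpen k r P a Λ)
    (B : Basis (Fin (r + 1)) k Λ) (τ : Equiv.Perm (Fin (r + 1)))
    (hB : ∀ j, ∀ i ≤ d,
      ((B j : H) ∈ Λ ⊓ P i ↔ r + 1 - (τ j).val ≤ finrank k ↥(Λ ⊓ P i)))
    (φ : Λ →ₗ[k] H ⧸ Λ) :
    φ ∈ schubertTangent k P a Λ {i | i ≤ r ∧ ActiveIdx a i} ↔
      ∀ j, φ (B j) ∈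
        (P (sSup {x | ∃ i ≤ (τ j).val, ActiveIdx a i ∧ x = a i})).map Λ.mkQ := by
  simp only [schubertTangent, mem_iInf, Set.mem_ofPred_eq]
  constructor
  · intro h j
    obtain ⟨i, hij, hsup, -, hact, -⟩ := exists_last_activeIdx ha (j := (τ j).val) (by lia)
    rw [hsup]
    rcases hact with hact | ⟨rfl, h0⟩
    · have hi : i ≤ r := by lia
      refine h i ⟨hi, hact⟩ (show (B j : H) ∈ P (a i) from ((hB j _ (had i hi).le).2 ?_).2)
      rw [hΛa.2 i hi hact]
      lia
    · rw [h0, hP.zero_eq_top hH, Submodule.map_top, range_mkQ]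
      trivial
  · rintro h i ⟨hi, hact⟩
    have hle : ∀ j : {j // i ≤ (τ j).val}, B j ∈ (P (a i)).comap Λ.subtype := fun j => by
      refine ((hB j _ (had i hi).le).2 ?_).2
      rw [hΛa.2 i hi hact]
      have := j.2
      lia
    have hspan : span k (Set.range fun j : {j // i ≤ (τ j).val} => B j) =
        (P (a i)).comap Λ.subtype := by
      refine Submodule.eq_of_le_of_finrank_eq (span_le.2 (Set.range_subset_iff.2 hle)) ?_
      rw [finrank_span_eq_card (b := fun j : {j // i ≤ (τ j).val} => B j)
          (B.linearIndependent.comp _ Subtype.val_injective),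
        ← finrank_map_subtype_eq, Submodule.map_comap_subtype, hΛa.2 i hi hact,
        Fintype.card_congr (τ.subtypeEquiv (p := fun j => i ≤ (τ j).val)
          (q := fun j => (⟨i, by lia⟩ : Fin (r + 1)) ≤ j)
          fun _ => Iff.rfl), Fintype.card_subtype, Finset.filter_le_eq_Ici, Fin.card_Ici]
    change (P (a i)).comap Λ.subtype ≤ ((P (a i)).map Λ.mkQ).comap φ
    rw [← hspan, span_le, Set.range_subset_iff]
    rintro ⟨j, hj⟩
    obtain ⟨l, hl, hsup, -, -, hmax⟩ := exists_last_activeIdx ha (j := (τ j).val) (by lia)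
    have hφ := h j
    rw [hsup] at hφ
    exact Submodule.map_mono (hP.le_of_le (hmax i hj hact) (had l (by lia)).le) hφ

end LinearAlgebra

/-- Theorem 2.11 of the paper: for
`Λ ∈ Σ°_{P,a} ∩ Σ°_{Q,b}` with associated permutation `σ`,
`dim T(Λ) = E + Σ_{j=0}^r (d - dim (P^{m(j)} + Q^{n(j)} + Λ))`, where
`m(j) = max {a_i : i active in a, i ≤ j}` (or `0`) and
`n(j) = max {b_i : i active in b, i ≤ σ(j)}` (or `0`). -/
theorem pairTangent_dim_formula (k H : Type*) [Field k] [IsAlgClosed k]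
    [AddCommGroup H] [Module k H] (d : ℕ) (hd : 1 ≤ d)
    (hH : Module.finrank k H = d) (P Q : ℕ → Submodule k H)
    (hP : IsCompleteFlag k d P) (hQ : IsCompleteFlag k d Q)
    (r : ℕ) (a b : ℕ → ℕ)
    (ha : ∀ i < r, a i < a (i + 1)) (had : a r < d)
    (hb : ∀ i < r, b i < b (i + 1)) (hbd : b r < d)
    (Λ : Submodule k H) (hΛ : Module.finrank k ↥Λ = r + 1)
    (hΛa : MemSchubertOpen k r P a Λ) (hΛb : MemSchubertOpen k r Q b Λ)
    (σ : Equiv.Perm (Fin (r + 1)))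
    (hσ : ∃ lam : Fin (r + 1) → H, IsAdaptedBasis k d r P Q Λ σ lam) :
    (Module.finrank k ↥(pairTangent k r P Q a b Λ) : ℤ) =
      (((r : ℤ) + 1) * ((d : ℤ) - (r : ℤ) - 1) -
          (∑ i ∈ Finset.range (r + 1), ((a i : ℤ) - (i : ℤ))) -
          (∑ i ∈ Finset.range (r + 1), ((b i : ℤ) - (i : ℤ)))) +
        ∑ j : Fin (r + 1),
          ((d : ℤ) - (Module.finrank k
            ↥(P (sSup {x | ∃ i ≤ j.val, ActiveIdx a i ∧ x = a i}) ⊔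
              Q (sSup {x | ∃ i ≤ (σ j).val, ActiveIdx b i ∧ x = b i}) ⊔ Λ) : ℤ)) := by
  have : FiniteDimensional k H := Module.finite_of_finrank_pos (by lia)
  have bound {c : ℕ → ℕ} (hc : ∀ i < r, c i < c (i + 1)) (hcd : c r < d) : ∀ i ≤ r, c i < d := by
    intro i hi
    induction hi using Nat.decreasingInduction with
    | self => exact hcd
    | of_succ i hi ih => exact (hc i hi).trans ih
  obtain ⟨lam, hli, hspan, hlamP, hlamQ⟩ := hσ
  let B : Basis (Fin (r + 1)) k Λ := (Basis.span hli).map (LinearEquiv.ofEq _ _ hspan)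
  have hB (j) : (B j : H) = lam j := by simp [B, Basis.span_apply]
  have hφP := mem_schubertTangent_iff_basis hP hH ha (bound ha had) hΛa B 1
    (by simpa only [hB, Equiv.Perm.one_apply] using hlamP)
  have hφQ := mem_schubertTangent_iff_basis hQ hH hb (bound hb hbd) hΛb B σ
    (by simpa only [hB] using hlamQ)
  rw [finrank_eq_sum_of_mem_iff_basis B
    (fun j => (P (sSup {x | ∃ i ≤ j.val, ActiveIdx a i ∧ x = a i})).map Λ.mkQ ⊓
      (Q (sSup {x | ∃ i ≤ (σ j).val, ActiveIdx b i ∧ x = b i})).map Λ.mkQ) _ fun φ => by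
      rw [pairTangent, mem_inf, hφP, hφQ, ← forall_and]
      rfl]
  have hdim (j : Fin (r + 1)) := finrank_sup_add_finrank_inf_eq
    ((P (sSup {x | ∃ i ≤ j.val, ActiveIdx a i ∧ x = a i})).map Λ.mkQ)
    ((Q (sSup {x | ∃ i ≤ (σ j).val, ActiveIdx b i ∧ x = b i})).map Λ.mkQ)
  have hsum := Equiv.sum_comp σ fun j => (b j : ℤ) - (j : ℕ)
  rw [Finset.sum_range fun i => (a i : ℤ) - (i : ℤ), Finset.sum_range fun i => (b i : ℤ) - (i : ℤ),
    ← hsum, Nat.cast_sum]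
  have hconst : ((r : ℤ) + 1) * ((d : ℤ) - r - 1) = ∑ _j : Fin (r + 1), ((d : ℤ) - r - 1) := by
    simp [-Finset.sum_sub_distrib]
  rw [hconst, ← Finset.sum_sub_distrib, ← Finset.sum_sub_distrib, ← Finset.sum_add_distrib]
  refine Finset.sum_congr rfl fun j _ => ?_
  have h := hdim j
  have hA := hΛa.finrank_map_mkQ hP hH ha (bound ha had) hΛ (j := j.val) (by lia)
  have hC := hΛb.finrank_map_mkQ hQ hH hb (bound hb hbd) hΛ (j := (σ j).val) (by lia)
  rw [← Submodule.map_sup] at h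
  have hS := finrank_map_mkQ_add_finrank Λ
    (P (sSup {x | ∃ i ≤ j.val, ActiveIdx a i ∧ x = a i}) ⊔
      Q (sSup {x | ∃ i ≤ (σ j).val, ActiveIdx b i ∧ x = b i}))
  lia
end
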